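/- arXiv:1612.05696 — 4 statements merged into one kernel-verified Lean document; each statement's English description precedes it below -/
import Mathlib

section
/- Let β > 1 and λ = β²/(2β−1). Then for every real x > 0 one has m(x) := (λ−1)(x^β + x^{−β}) − λ(x^{β−1} + x^{1−β}) + 2 ≥ 0. -/
theorem Real.mul_sinh_mul_le_mul_sinh_mul {a b s : ℝ} (hb : 0 ≤ b) (hab : b ≤ a) (hs : 0 ≤ s) :
    a * Real.sinh (b * s) ≤ b * Real.sinh (a * s) := by
  have hderiv (c d t : ℝ) :
      HasDerivAt (fun t => d * Real.sinh (c * t)) (d * (Real.cosh (c * t) * c)) t := by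
    simpa using (((hasDerivAt_id t).const_mul c).sinh).const_mul d
  have hmono : MonotoneOn (fun t => b * Real.sinh (a * t) - a * Real.sinh (b * t))
      (Set.Ici 0) := by
    refine monotoneOn_of_hasDerivWithinAt_nonneg (convex_Ici 0) (by fun_prop)
      (fun t _ => ((hderiv a b t).sub (hderiv b a t)).hasDerivWithinAt) fun t ht => ?_
    rw [interior_Ici, Set.mem_Ioi] at ht
    have hcosh : Real.cosh (b * t) ≤ Real.cosh (a * t) := by
      rw [Real.cosh_le_cosh, abs_of_nonneg (by positivity),
        abs_of_nonneg (mul_nonneg (hb.trans hab) ht.le)]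
      gcongr
    nlinarith [mul_le_mul_of_nonneg_left hcosh (mul_nonneg hb (hb.trans hab))]
  simpa using hmono Set.self_mem_Ici hs hs

theorem Real.sq_mul_cosh_mul_sub_one_le {a b : ℝ} (hb : 0 ≤ b) (hab : b ≤ a) (t : ℝ) :
    a ^ 2 * (Real.cosh (b * t) - 1) ≤ b ^ 2 * (Real.cosh (a * t) - 1) := by
  wlog ht : 0 ≤ t generalizing t
  · simpa using this (-t) (by linarith)
  have hcosh (c : ℝ) : Real.cosh (c * t) - 1 = 2 * Real.sinh (c * (t / 2)) ^ 2 := by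
    rw [show c * t = 2 * (c * (t / 2)) by ring, Real.cosh_two_mul, Real.cosh_sq']
    ring
  have hsinh : 0 ≤ a * Real.sinh (b * (t / 2)) :=
    mul_nonneg (hb.trans hab) (Real.sinh_nonneg_iff.2 (by positivity))
  have hsq := pow_le_pow_left₀ hsinh
    (Real.mul_sinh_mul_le_mul_sinh_mul hb hab (div_nonneg ht zero_le_two)) 2
  rw [hcosh, hcosh]
  linarith [mul_pow a (Real.sinh (b * (t / 2))) 2, mul_pow b (Real.sinh (a * (t / 2))) 2]

theorem Real.rpow_add_rpow_neg {x : ℝ} (hx : 0 < x) (c : ℝ) :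
    x ^ c + x ^ (-c) = 2 * Real.cosh (c * Real.log x) := by
  rw [Real.rpow_def_of_pos hx, Real.rpow_def_of_pos hx, Real.cosh_eq, mul_comm c, mul_neg]
  ring

/-- Remark 4.1 (first part): for `β > 1` and `λ = β²/(2β−1)`,
`m(x) = (λ−1)(x^β + x^{−β}) − λ(x^{β−1} + x^{1−β}) + 2 ≥ 0` for all `x > 0`. -/
theorem m_nonneg (β lam : ℝ) (hβ : 1 < β) (hlam : lam = β ^ 2 / (2 * β - 1)) :
    ∀ x : ℝ, 0 < x →
      0 ≤ (lam - 1) * (x ^ β + x ^ (-β)) - lam * (x ^ (β - 1) + x ^ (1 - β)) + 2 := by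
  intro x hx
  have hden : 0 < 2 * β - 1 := by linarith
  rw [eq_div_iff hden.ne'] at hlam
  have key := Real.sq_mul_cosh_mul_sub_one_le (sub_nonneg.2 hβ.le) (sub_le_self β zero_le_one)
    (Real.log x)
  rw [← neg_sub β 1, Real.rpow_add_rpow_neg hx, Real.rpow_add_rpow_neg hx]
  generalize Real.cosh (β * Real.log x) = A at *
  generalize Real.cosh ((β - 1) * Real.log x) = B at *
  have heq : ((lam - 1) * (2 * A) - lam * (2 * B) + 2) * (2 * β - 1) =
      2 * ((β - 1) ^ 2 * (A - 1) - β ^ 2 * (B - 1)) := by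
    linear_combination (2 * A - 2 * B) * hlam
  exact nonneg_of_mul_nonneg_left (by linarith) hden
end

section
/- Let β > 1 and λ = β²/(2β−1). Then for every real x > 0 one has p(x) := (λ−1)(x^β + x^{−β}) + λ(x^{β−1} + x^{1−β}) − 2 ≥ 0. -/
theorem Real.two_le_rpow_add_rpow_neg {x : ℝ} (hx : 0 < x) (a : ℝ) : 2 ≤ x ^ a + x ^ (-a) := by
  have h : x ^ a * x ^ (-a) = 1 := by rw [← Real.rpow_add hx, add_neg_cancel, Real.rpow_zero]
  nlinarith [sq_nonneg (x ^ a - x ^ (-a)), Real.rpow_pos_of_pos hx a,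
    Real.rpow_pos_of_pos hx (-a)]

/-- Remark 4.1 (second part): for `β > 1` and `λ = β²/(2β−1)`,
`p(x) = (λ−1)(x^β + x^{−β}) + λ(x^{β−1} + x^{1−β}) − 2 ≥ 0` for all `x > 0`. -/
theorem p_nonneg (β lam : ℝ) (hβ : 1 < β) (hlam : lam = β ^ 2 / (2 * β - 1)) :
    ∀ x : ℝ, 0 < x →
      0 ≤ (lam - 1) * (x ^ β + x ^ (-β)) + lam * (x ^ (β - 1) + x ^ (1 - β)) - 2 := by
  intro x hx
  have one_le_lam : 1 ≤ lam := by
    rw [hlam, one_le_div (by linarith)]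
    nlinarith [sq_nonneg (β - 1)]
  have h₁ := Real.two_le_rpow_add_rpow_neg hx β
  have h₂ := Real.two_le_rpow_add_rpow_neg hx (β - 1)
  rw [neg_sub] at h₂
  nlinarith [mul_nonneg (sub_nonneg.2 one_le_lam) (sub_nonneg.2 h₁),
    mul_nonneg (zero_le_one.trans one_le_lam) (sub_nonneg.2 h₂)]
end

section
/- Let β > 1 and λ = β²/(2β−1). Then for all real numbers x, y: λ(x−y)(x|x|^{2(β−1)} − y|y|^{2(β−1)}) ≥ (x|x|^{β−1} − y|y|^{β−1})². Equivalently, the mean-value points θ₁(x,y), θ₂(x,y) of the functions t ↦ t|t|^{2(β−1)} and t ↦ t|t|^{β−1} satisfy |θ₁(x,y)| ≥ |θ₂(x,y)| for all x, y ∈ ℝ. -/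
/-- The odd power `t ↦ t|t|^a` is differentiable everywhere when `a > 0`. -/
theorem hasDerivAt_mul_abs_rpow {a : ℝ} (ha : 0 < a) (t : ℝ) :
    HasDerivAt (fun s : ℝ => s * |s| ^ a) ((a + 1) * |t| ^ a) t := by
  rcases eq_or_ne t 0 with rfl | ht
  · rw [abs_zero, Real.zero_rpow ha.ne', mul_zero, hasDerivAt_iff_tendsto_slope]
    have hc : Filter.Tendsto (fun s : ℝ => |s| ^ a) (nhdsWithin 0 {0}ᶜ) (nhds 0) := by
      have h : ContinuousAt (fun s : ℝ => |s| ^ a) 0 :=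
        continuous_abs.continuousAt.rpow_const (Or.inr ha.le)
      have h' := h.tendsto
      simp only [abs_zero, Real.zero_rpow ha.ne'] at h'
      exact h'.mono_left nhdsWithin_le_nhds
    refine hc.congr' ?_
    filter_upwards [self_mem_nhdsWithin] with s hs
    have hs' : s ≠ 0 := hs
    simp [slope_def_field, hs']
  · have h := (hasDerivAt_id t).mul
      ((hasDerivAt_abs ht).rpow_const (p := a) (Or.inl (abs_ne_zero.mpr ht)))
    refine h.congr_deriv ?_
    have hp : |t| ^ a = |t| * |t| ^ (a - 1) := by
      rw [Real.rpow_sub_one (abs_ne_zero.mpr ht), mul_div_cancel₀ _ (abs_ne_zero.mpr ht)]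
    have hsign : t * (SignType.sign t : ℝ) = |t| := self_mul_sign t
    simp only [id_eq]
    linear_combination (a * |t| ^ (a - 1)) * hsign - a * hp

/-- The Cauchy–Schwarz inequality for `∫ |t|^a`, with both integrals written out as
differences of primitives. -/
theorem sq_sub_mul_abs_rpow_le {a : ℝ} (ha : 0 < a) {x y : ℝ} (hxy : y ≤ x) :
    ((x * |x| ^ a - y * |y| ^ a) / (a + 1)) ^ 2 ≤
      (x - y) * ((x * |x| ^ (2 * a) - y * |y| ^ (2 * a)) / (2 * a + 1)) := by
  rcases hxy.eq_or_lt with rfl | hlt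
  · simp
  have hmono (c : ℝ) : Monotone (fun t : ℝ =>
      t * |t| ^ (2 * a) / (2 * a + 1) - 2 * c * (t * |t| ^ a / (a + 1)) + c ^ 2 * t) := by
    refine monotone_of_hasDerivAt_nonneg (f' := fun t => (|t| ^ a - c) ^ 2) (fun t => ?_)
      (fun t => sq_nonneg _)
    have h := (((hasDerivAt_mul_abs_rpow (a := 2 * a) (by positivity) t).div_const
      (2 * a + 1)).sub (((hasDerivAt_mul_abs_rpow ha t).div_const (a + 1)).const_mul
      (2 * c))).add ((hasDerivAt_id t).const_mul (c ^ 2))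
    refine h.congr_deriv ?_
    have hp : |t| ^ (2 * a) = (|t| ^ a) ^ 2 := by
      rw [mul_comm, Real.rpow_mul (abs_nonneg t), Real.rpow_two]
    rw [mul_div_cancel_left₀ _ (by positivity), mul_div_cancel_left₀ _ (by positivity), hp]
    ring
  set Q := (x * |x| ^ a - y * |y| ^ a) / (a + 1) with hQ
  set P := (x * |x| ^ (2 * a) - y * |y| ^ (2 * a)) / (2 * a + 1) with hP
  have hD : 0 < x - y := sub_pos.mpr hlt
  have h : 0 ≤ P - 2 * (Q / (x - y)) * Q + (Q / (x - y)) ^ 2 * (x - y) := by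
    have := hmono (Q / (x - y)) hxy
    simp only at this
    rw [sub_div] at hP hQ
    linear_combination this + hP - 2 * (Q / (x - y)) * hQ
  have h' : P - 2 * (Q / (x - y)) * Q + (Q / (x - y)) ^ 2 * (x - y) = P - Q ^ 2 / (x - y) := by
    field_simp
    ring
  rw [h', sub_nonneg, div_le_iff₀ hD] at h
  linarith


/-- Lemma 4.4: for `β > 1` and `λ = β²/(2β−1)`, for all real `x, y`,
`λ(x−y)(x|x|^{2(β−1)} − y|y|^{2(β−1)}) ≥ (x|x|^{β−1} − y|y|^{β−1})²`.
Equivalently, the mean-value points `θ₁(x,y)`, `θ₂(x,y)` of `t ↦ t|t|^{2(β−1)}` and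
`t ↦ t|t|^{β−1}` satisfy `|θ₁(x,y)| ≥ |θ₂(x,y)|` for all `x, y ∈ ℝ`. -/
theorem theta_comparison (β lam : ℝ) (hβ : 1 < β) (hlam : lam = β ^ 2 / (2 * β - 1)) :
    (∀ x y : ℝ,
      lam * (x - y) * (x * |x| ^ (2 * (β - 1)) - y * |y| ^ (2 * (β - 1))) ≥
        (x * |x| ^ (β - 1) - y * |y| ^ (β - 1)) ^ 2) ∧
    ∀ θ₁ θ₂ : ℝ → ℝ → ℝ,
      (∀ x y : ℝ, x ≠ y →
        (2 * β - 1) * |θ₁ x y| ^ (2 * (β - 1)) =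
          (x * |x| ^ (2 * (β - 1)) - y * |y| ^ (2 * (β - 1))) / (x - y)) →
      (∀ x : ℝ, θ₁ x x = 0) →
      (∀ x y : ℝ, x ≠ y →
        β * |θ₂ x y| ^ (β - 1) =
          (x * |x| ^ (β - 1) - y * |y| ^ (β - 1)) / (x - y)) →
      (∀ x : ℝ, θ₂ x x = 0) →
      ∀ x y : ℝ, |θ₁ x y| ≥ |θ₂ x y| := by
  have hβ1 : 0 < β - 1 := sub_pos.mpr hβ
  have h2 : 0 < 2 * β - 1 := by linarith
  have main (x y : ℝ) : (x * |x| ^ (β - 1) - y * |y| ^ (β - 1)) ^ 2 ≤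
      lam * (x - y) * (x * |x| ^ (2 * (β - 1)) - y * |y| ^ (2 * (β - 1))) := by
    wlog hxy : y ≤ x generalizing x y
    · linarith [this y x (le_of_not_ge hxy)]
    have h := sq_sub_mul_abs_rpow_le hβ1 hxy
    rw [sub_add_cancel, show 2 * (β - 1) + 1 = 2 * β - 1 by ring, div_pow,
      div_le_iff₀ (by positivity)] at h
    rw [hlam]
    refine h.trans_eq ?_
    ring
  refine ⟨main, fun θ₁ θ₂ h₁ h₁0 h₂ h₂0 x y => ?_⟩
  rcases eq_or_ne x y with rfl | hne
  · rw [h₁0, h₂0]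
  have hD : x - y ≠ 0 := sub_ne_zero.mpr hne
  have e₁ := (eq_div_iff hD).mp (h₁ x y hne)
  have e₂ := (eq_div_iff hD).mp (h₂ x y hne)
  have h := main x y
  have hp : |θ₂ x y| ^ (2 * (β - 1)) = (|θ₂ x y| ^ (β - 1)) ^ 2 := by
    rw [mul_comm, Real.rpow_mul (abs_nonneg _), Real.rpow_two]
  have hl : lam * (2 * β - 1) = β ^ 2 := by rw [hlam, div_mul_cancel₀ _ h2.ne']
  rw [← e₁, ← e₂] at h
  have hpos : 0 < (β * (x - y)) ^ 2 := by positivity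
  have hle : |θ₂ x y| ^ (2 * (β - 1)) ≤ |θ₁ x y| ^ (2 * (β - 1)) := by
    refine le_of_mul_le_mul_left ?_ hpos
    rw [hp]
    linear_combination h + (x - y) ^ 2 * |θ₁ x y| ^ (2 * (β - 1)) * hl
  exact (Real.rpow_le_rpow_iff (abs_nonneg _) (abs_nonneg _) (by positivity)).mp hle
end

section
/- Let β > 1, let N > 0 be a real number, and set C = 2 + 2(β−1)²/(2β−1). Then for all real s, t with |s| > N^{1/(β−1)} and |t| ≤ N^{1/(β−1)}, one has 2(Ns − t|t|^{β−1})² ≤ C(s−t)(N²s − t|t|^{2(β−1)}). -/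
/-- The Cauchy–Schwarz inequality for `x ↦ x ^ γ` and `1` on `[r, 1]`, in closed form. -/
lemma sq_one_sub_rpow_le {γ r : ℝ} (hγ : 0 < γ) (hr0 : 0 ≤ r) (hr1 : r ≤ 1) :
    (1 - r * r ^ γ) ^ 2 ≤
      (γ + 1) ^ 2 / (2 * γ + 1) * ((1 - r) * (1 - r * (r ^ γ) ^ 2)) := by
  have hr_pow : r ^ (γ + 1) = r * r ^ γ := by
    rw [Real.rpow_add_one' hr0 (by linarith), mul_comm]
  have hr_pow_sq : r ^ (2 * γ + 1) = r * (r ^ γ) ^ 2 := by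
    rw [Real.rpow_add_one' hr0 (by linarith), mul_comm, mul_comm 2 γ, Real.rpow_mul hr0,
      Real.rpow_two]
  have quadratic_nonneg : ∀ c : ℝ,
      0 ≤ (1 - r) * (c * c) + (-2 * ((1 - r * r ^ γ) / (γ + 1))) * c
        + (1 - r * (r ^ γ) ^ 2) / (2 * γ + 1) := by
    intro c
    have hint : ∫ x in r..1, (c * c - 2 * c * x ^ γ + x ^ (2 * γ)) =
        (1 - r) * (c * c) + (-2 * ((1 - r * r ^ γ) / (γ + 1))) * c
          + (1 - r * (r ^ γ) ^ 2) / (2 * γ + 1) := by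
      have hi₁ : IntervalIntegrable (fun x : ℝ => x ^ γ) MeasureTheory.volume r 1 :=
        intervalIntegral.intervalIntegrable_rpow' (by linarith)
      have hi₂ : IntervalIntegrable (fun x : ℝ => x ^ (2 * γ)) MeasureTheory.volume r 1 :=
        intervalIntegral.intervalIntegrable_rpow' (by linarith)
      rw [intervalIntegral.integral_add
          (intervalIntegrable_const.sub (hi₁.const_mul _)) hi₂,
        intervalIntegral.integral_sub intervalIntegrable_const (hi₁.const_mul _),
        intervalIntegral.integral_const,
        intervalIntegral.integral_const_mul (2 * c) fun x : ℝ => x ^ γ,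
        integral_rpow (Or.inl (by linarith)), integral_rpow (Or.inl (by linarith)),
        Real.one_rpow, Real.one_rpow, hr_pow, hr_pow_sq, smul_eq_mul]
      ring
    rw [← hint]
    refine intervalIntegral.integral_nonneg hr1 fun x hx => ?_
    have hx_pow : x ^ (2 * γ) = (x ^ γ) ^ 2 := by
      rw [mul_comm, Real.rpow_mul (hr0.trans hx.1), Real.rpow_two]
    rw [hx_pow]
    nlinarith [sq_nonneg (c - x ^ γ)]
  have hdisc := discrim_le_zero quadratic_nonneg
  rw [discrim] at hdisc
  have h : ((1 - r * r ^ γ) / (γ + 1)) ^ 2 ≤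
      (1 - r) * ((1 - r * (r ^ γ) ^ 2) / (2 * γ + 1)) := by linarith
  rw [div_pow, div_le_iff₀ (by positivity)] at h
  calc _ ≤ _ := h
    _ = _ := by ring

lemma sq_sub_mul_le_of_le {K θ t m s : ℝ} (hK : 1 ≤ K) (hθ0 : 0 ≤ θ) (hθ1 : θ ≤ 1)
    (ht : 0 ≤ t) (htm : t ≤ m) (hm : 0 < m) (hms : m ≤ s)
    (h : (m - t * θ) ^ 2 ≤ K * ((m - t) * (m - t * θ ^ 2))) :
    (s - t * θ) ^ 2 ≤ K * ((s - t) * (s - t * θ ^ 2)) := by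
  have hcoef : 0 ≤ K * (1 + θ ^ 2) - 2 * θ - 2 * ((K - 1) * θ ^ 2) := by
    have hfac : 0 ≤ K * (1 + θ) - 2 * θ := by nlinarith
    nlinarith [mul_nonneg (sub_nonneg.2 hθ1) hfac]
  have htsm : t * (s + m) ≤ 2 * (s * m) := by nlinarith
  have hK' : 0 ≤ (K - 1) * θ ^ 2 := mul_nonneg (by linarith) (sq_nonneg _)
  have hbracket :
      0 ≤ s * m * (K * (1 + θ ^ 2) - 2 * θ) - (K - 1) * θ ^ 2 * (t * (s + m)) := by
    have hsm : 0 ≤ s * m := mul_nonneg (by linarith) hm.le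
    nlinarith [mul_nonneg hsm hcoef, mul_le_mul_of_nonneg_left htsm hK']
  have hprod := mul_nonneg (mul_nonneg ht (sub_nonneg.2 hms)) hbracket
  have hscaled := mul_le_mul_of_nonneg_left h (sq_nonneg s)
  refine le_of_mul_le_mul_left ?_ (pow_pos hm 2)
  linarith

lemma sq_sub_mul_le_of_nonpos {K θ t s : ℝ} (hK : 1 ≤ K) (ht : t ≤ 0) (hs : 0 ≤ s) :
    (s - t * θ) ^ 2 ≤ K * ((s - t) * (s - t * θ ^ 2)) := by
  have hst : 0 ≤ s * -t := mul_nonneg hs (by linarith)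
  have hprod : 0 ≤ (s - t) * (s - t * θ ^ 2) :=
    mul_nonneg (by linarith) (by nlinarith [mul_nonneg (neg_nonneg.2 ht) (sq_nonneg θ)])
  nlinarith [mul_le_mul_of_nonneg_right hK hprod, mul_nonneg hst (sq_nonneg (1 - θ))]

/-- The inequality (4.24): for `β > 1`, `N > 0` and `C = 2 + 2(β−1)²/(2β−1)`, for all real
`s, t` with `|s| > N^{1/(β−1)}` and `|t| ≤ N^{1/(β−1)}` one has
`2(Ns − t|t|^{β−1})² ≤ C(s−t)(N²s − t|t|^{2(β−1)})`. -/
theorem r_nonpos (β N C : ℝ) (hβ : 1 < β) (hN : 0 < N)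
    (hC : C = 2 + 2 * (β - 1) ^ 2 / (2 * β - 1)) :
    ∀ s t : ℝ, N ^ (1 / (β - 1)) < |s| → |t| ≤ N ^ (1 / (β - 1)) →
      2 * (N * s - t * |t| ^ (β - 1)) ^ 2 ≤
        C * (s - t) * (N ^ 2 * s - t * |t| ^ (2 * (β - 1))) := by
  intro s t hs ht
  obtain ⟨γ, rfl⟩ : ∃ γ, β = γ + 1 := ⟨β - 1, by ring⟩
  have hγ : 0 < γ := by linarith
  simp only [add_sub_cancel_right] at *
  set m := N ^ (1 / γ) with hm_def
  have hm : 0 < m := Real.rpow_pos_of_pos hN _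
  have hmN : m ^ γ = N := by
    rw [hm_def, ← Real.rpow_mul hN.le, one_div_mul_cancel hγ.ne', Real.rpow_one]
  set K := (γ + 1) ^ 2 / (2 * γ + 1) with hK_def
  have hCK : C = 2 * K := by
    rw [hC, hK_def, show 2 * (γ + 1) - 1 = 2 * γ + 1 by ring]
    field_simp
    ring
  have hK : 1 ≤ K := by
    rw [hK_def, le_div_iff₀ (by positivity)]
    nlinarith [sq_nonneg γ]
  set r := |t| / m with hr_def
  have hr0 : 0 ≤ r := by positivity
  have hr1 : r ≤ 1 := (div_le_one hm).2 ht
  have htr : |t| = m * r := by rw [hr_def]; field_simp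
  set θ := r ^ γ with hθ_def
  have hθ0 : 0 ≤ θ := Real.rpow_nonneg hr0 _
  have hθ1 : θ ≤ 1 := Real.rpow_le_one hr0 hr1 hγ.le
  have htγ : |t| ^ γ = N * θ := by rw [htr, Real.mul_rpow hm.le hr0, hmN]
  have htγ_sq : |t| ^ (2 * γ) = (N * θ) ^ 2 := by
    rw [mul_comm, Real.rpow_mul (abs_nonneg t), htγ, Real.rpow_two]
  have hbase : (m - |t| * θ) ^ 2 ≤ K * ((m - |t|) * (m - |t| * θ ^ 2)) := by
    rw [htr]
    nlinarith [mul_le_mul_of_nonneg_left (sq_one_sub_rpow_le hγ hr0 hr1) (sq_nonneg m)]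
  have main : ∀ S T : ℝ, m ≤ S → |T| = |t| →
      (S - T * θ) ^ 2 ≤ K * ((S - T) * (S - T * θ ^ 2)) := by
    intro S T hS hT
    rcases le_total T 0 with hT0 | hT0
    · exact sq_sub_mul_le_of_nonpos hK hT0 (hm.le.trans hS)
    · rw [abs_of_nonneg hT0] at hT
      subst hT
      exact sq_sub_mul_le_of_le hK hθ0 hθ1 hT0 ht hm hS hbase
  have hst : (s - t * θ) ^ 2 ≤ K * ((s - t) * (s - t * θ ^ 2)) := by
    rcases le_total 0 s with hs0 | hs0
    · exact main s t (by rw [abs_of_nonneg hs0] at hs; exact hs.le) rfl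
    · have h := main (-s) (-t) (by rw [abs_of_nonpos hs0] at hs; exact hs.le) (abs_neg t)
      linarith
  rw [htγ, htγ_sq, hCK]
  linarith [mul_le_mul_of_nonneg_left hst (sq_nonneg N)]
end
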